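/- Let E be a field of characteristic p and let m > 1 with gcd(m, p) = 1 if p > 0. Suppose f ∈ E[x] divides (x^m − 1)/((x − 1)·Φ_m(x)), where Φ_m is the m-th cyclotomic polynomial over E. Then no zero of f (in any extension of E) has multiplicative order m; consequently, if s is an f-sequence of period m presenting a multiplicative subgroup M of order m, then s is not cyclic, so M is a non-standard f-subgroup. -/

import Mathlib

open Polynomial

/-- `lrsApply f s` is the sequence `f(σ)s`, where `σ` is the left-shift operator:
`(f(σ)s)_n = ∑_i (coeff of x^i in f) * s_{n+i}`. -/
noncomputable def lrsApply {F : Type*} [CommRing F] (f : Polynomial F) (s : ℤ → F) : ℤ → F :=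
  fun n => ∑ i ∈ Finset.range (f.natDegree + 1), f.coeff i * s (n + i)

theorem X_sub_one_mul_cyclotomic_dvd_X_pow_sub_one (R : Type*) [CommRing R] {m : ℕ}
    (hm : 1 < m) : (X - 1) * cyclotomic m R ∣ X ^ m - 1 := by
  simpa using X_pow_sub_one_mul_cyclotomic_dvd_X_pow_sub_one_of_dvd R
    (Nat.mem_properDivisors.2 ⟨one_dvd m, hm⟩)

theorem natCast_ne_zero_of_coprime_ringChar {E : Type*} [Field E] {m : ℕ} (hm : 1 < m)
    (hchar : ringChar E = 0 ∨ Nat.Coprime m (ringChar E)) : (m : E) ≠ 0 := by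
  intro h
  have hdvd := (ringChar.spec E m).1 h
  rcases hchar with h0 | hcop
  · rw [h0, zero_dvd_iff] at hdvd
    omega
  · have h1 : ringChar E = 1 := Nat.eq_one_of_dvd_coprimes hcop hdvd dvd_rfl
    exact CharP.ringChar_ne_one h1

theorem orderOf_ne_of_dvd_quotient_by_cyclotomic {E K : Type*} [Field E] [Field K] {m : ℕ}
    (hm : 1 < m) (hmE : (m : E) ≠ 0) {f : E[X]}
    (hf : f ∣ (X ^ m - 1) / ((X - 1) * cyclotomic m E)) (ι : E →+* K) {a : K}
    (ha : (f.map ι).eval a = 0) : orderOf a ≠ m := by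
  intro hord
  have hroot : (cyclotomic m K).eval a = 0 :=
    (hord ▸ IsPrimitiveRoot.orderOf a).isRoot_cyclotomic (by omega)
  have hsep : (X ^ m - 1 : E[X]).Separable := by
    simpa using separable_X_pow_sub_C (1 : E) hmE one_ne_zero
  have hmul := EuclideanDomain.mul_div_cancel' (b := (X - 1) * cyclotomic m E)
    (mul_ne_zero (by simpa using X_sub_C_ne_zero (1 : E)) (cyclotomic_ne_zero m E))
    (X_sub_one_mul_cyclotomic_dvd_X_pow_sub_one E hm)
  rw [← hmul] at hsep
  obtain ⟨u, v, huv⟩ :=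
    (hsep.isCoprime.of_isCoprime_of_dvd_left (dvd_mul_left _ _)).of_isCoprime_of_dvd_right hf
  have h := congrArg (fun q : E[X] => (q.map ι).eval a) huv
  simp [hroot, ha] at h

theorem orderOf_eq_of_cyclic_of_injective {E : Type*} [Field E] {m : ℕ} (hm : 0 < m)
    {s : ℤ → E} {c : E} (hper : s m = s 0) (h0 : s 0 ≠ 0)
    (hpow : ∀ n : ℕ, s n = c ^ n * s 0)
    (hinj : Function.Injective fun i : Fin m => s ((i : ℕ) : ℤ)) : orderOf c = m := by
  rw [orderOf_eq_iff hm]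
  refine ⟨mul_right_cancel₀ h0 ?_, fun k hk hk0 hck => ?_⟩
  · rw [← hpow, hper, one_mul]
  · have h : (⟨k, hk⟩ : Fin m) = ⟨0, hm⟩ := hinj (by simp [hpow k, hck])
    exact hk0.ne' (Fin.mk.inj h)

theorem lrsApply_zero_of_cyclic {F : Type*} [CommRing F] (f : F[X]) {s : ℤ → F} {c : F}
    (hpow : ∀ n : ℕ, s n = c ^ n * s 0) : lrsApply f s 0 = f.eval c * s 0 := by
  simp [lrsApply, hpow, eval_eq_sum_range, Finset.sum_mul, mul_assoc]

/-- Let `E` be a field of characteristic `p` and `m > 1` with `gcd(m, p) = 1` if `p > 0`.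
If `f ∈ E[x]` divides `(x^m - 1)/((x - 1)·Φ_m(x))`, then no zero of `f` in any extension
of `E` has multiplicative order `m`; consequently, any `f`-sequence of period `m`
presenting a multiplicative subgroup `M` of order `m` is not cyclic, so `M` is a
non-standard `f`-subgroup. -/
theorem nonstandard_of_dvd_quotient_by_cyclotomic.{u, v} {E : Type v} [Field E]
    (m : ℕ) (hm : 1 < m)
    (hchar : ringChar E = 0 ∨ Nat.Coprime m (ringChar E))
    (f : Polynomial E) (hf : f ∣ (X ^ m - 1) / ((X - 1) * cyclotomic m E)) :
    (∀ (K : Type u) [Field K], ∀ (ι : E →+* K) (a : K), (f.map ι).eval a = 0 → orderOf a ≠ m) ∧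
    (∀ (s : ℤ → E) (M : Subgroup Eˣ), Nat.card M = m →
      lrsApply f s = 0 →
      (∀ n : ℤ, s (n + m) = s n) →
      (Function.Injective fun i : Fin m => s ((i : ℕ) : ℤ)) →
      ((Set.range fun i : Fin m => s ((i : ℕ) : ℤ)) = ((↑) : Eˣ → E) '' M) →
      ¬∃ c : E, ∀ n : ℤ, s (n + 1) = c * s n) := by
  have hmE := natCast_ne_zero_of_coprime_ringChar hm hchar
  refine ⟨fun K _ ι a ha => orderOf_ne_of_dvd_quotient_by_cyclotomic hm hmE hf ι ha, ?_⟩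
  rintro s M - hfs hper hinj hrange ⟨c, hc⟩
  have hpow : ∀ n : ℕ, s n = c ^ n * s 0 := by
    intro n
    induction n with
    | zero => simp
    | succ k ih => rw [Nat.cast_succ, hc, ih, pow_succ']; ring
  have h0 : s 0 ≠ 0 := by
    have hmem : s 0 ∈ ((↑) : Eˣ → E) '' M := hrange ▸ ⟨⟨0, by omega⟩, by simp⟩
    obtain ⟨u, -, hu⟩ := hmem
    exact hu ▸ u.ne_zero
  have heval : f.eval c = 0 := by
    have h := lrsApply_zero_of_cyclic f hpow
    rw [hfs] at h
    exact (mul_eq_zero.1 h.symm).resolve_right h0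
  exact orderOf_ne_of_dvd_quotient_by_cyclotomic hm hmE hf (RingHom.id E) (by simpa using heval)
    (orderOf_eq_of_cyclic_of_injective (by omega) (by simpa using hper 0) h0 hpow hinj)
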